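/- Let G be a connected claw-free graph and let I, J be independent sets with |I| = |J|. Then there is a TS-sequence from I to J if and only if every cycle of G[I △ J] is resolvable with respect to I. -/

import Mathlib

open SimpleGraph

/-- A graph is claw-free if no vertex has three pairwise nonadjacent neighbors. -/
def ClawFree {V : Type} (G : SimpleGraph V) : Prop :=
  ¬ ∃ v a b c : V, G.Adj v a ∧ G.Adj v b ∧ G.Adj v c ∧
    a ≠ b ∧ a ≠ c ∧ b ≠ c ∧ ¬G.Adj a b ∧ ¬G.Adj a c ∧ ¬G.Adj b c

/-- `s` is an independent set of `G`. -/
def Indep {V : Type} (G : SimpleGraph V) (s : Set V) : Prop :=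
  ∀ u ∈ s, ∀ v ∈ s, ¬G.Adj u v

/-- Token sliding step between independent sets. -/
def TSStep {V : Type} (G : SimpleGraph V) (I J : Set V) : Prop :=
  Indep G I ∧ Indep G J ∧ ∃ u v : V, G.Adj u v ∧ I \ J = {u} ∧ J \ I = {v}

/-- Token jumping step between independent sets. -/
def TJStep {V : Type} (G : SimpleGraph V) (I J : Set V) : Prop :=
  Indep G I ∧ Indep G J ∧ ∃ u v : V, I \ J = {u} ∧ J \ I = {v}

/-- Reachability under token sliding. -/
def TSReach {V : Type} (G : SimpleGraph V) : Set V → Set V → Prop :=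
  Relation.ReflTransGen (TSStep G)

/-- Reachability under token jumping. -/
def TJReach {V : Type} (G : SimpleGraph V) : Set V → Set V → Prop :=
  Relation.ReflTransGen (TJStep G)

/-- The neighbors of `v` inside the set `B`. -/
def nbrsIn {V : Type} (G : SimpleGraph V) (B : Set V) (v : V) : Set V :=
  {u ∈ B | G.Adj v u}

/-- `Nset G B i` is the set `N_i(B)` of vertices outside `B` with exactly `i` neighbors in `B`. -/
def Nset {V : Type} (G : SimpleGraph V) (B : Set V) (i : ℕ) : Set V :=
  {v | v ∉ B ∧ (nbrsIn G B v).ncard = i}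

/-- The neighborhood of a set. -/
def Nbhd {V : Type} (G : SimpleGraph V) (S : Set V) : Set V :=
  {w | ∃ u ∈ S, G.Adj w u}

/-- An `I`-bad cycle: a chordless `I`-alternating cycle `c 0, c 1, …, c (2n-1), c 0`
with `c j ∈ I` exactly for even `j`. -/
def IsBadCycle {V : Type} (G : SimpleGraph V) (I : Set V) (n : ℕ) (c : ZMod (2*n) → V) : Prop :=
  2 ≤ n ∧ Function.Injective c ∧
  (∀ j : ZMod (2*n), G.Adj (c j) (c (j + 1))) ∧
  (∀ i j : ZMod (2*n), G.Adj (c i) (c j) → j = i + 1 ∨ i = j + 1) ∧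
  (∀ j : ZMod (2*n), c j ∈ I ↔ Even (ZMod.val j))

/-- The part `A = V(C) ∩ I` of the `I`-bipartition of a bad cycle. -/
def cycA {V : Type} {n : ℕ} (c : ZMod (2*n) → V) : Set V :=
  c '' {j | Even (ZMod.val j)}

/-- The part `B = V(C) \ I` of the `I`-bipartition of a bad cycle. -/
def cycB {V : Type} {n : ℕ} (c : ZMod (2*n) → V) : Set V :=
  c '' {j | ¬ Even (ZMod.val j)}

/-- The bad cycle `c` is resolvable with respect to `I`. -/
def Resolvable {V : Type} (G : SimpleGraph V) (I : Set V) {n : ℕ} (c : ZMod (2*n) → V) : Prop :=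
  ∃ I' : Set V, TSReach G I I' ∧ (G.induce (I' ∪ cycB c)).IsAcyclic

/-- A vertex is free w.r.t. `I` if it is outside `I` and has at most one neighbor in `I`. -/
def FreeVert {V : Type} (G : SimpleGraph V) (I : Set V) (v : V) : Prop :=
  v ∉ I ∧ (nbrsIn G I v).ncard ≤ 1

/-- An `I`-augmenting path `x 0, x 1, …, x (2k)`: an `I`-alternating chordless path of
length `2k ≥ 2` whose endpoints are free vertices. -/
def IsAugPath {V : Type} (G : SimpleGraph V) (I : Set V) (k : ℕ) (x : Fin (2*k+1) → V) : Prop :=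
  1 ≤ k ∧ Function.Injective x ∧
  (∀ j : Fin (2*k), G.Adj (x j.castSucc) (x j.succ)) ∧
  (∀ i j : Fin (2*k+1), G.Adj (x i) (x j) → i.val + 1 = j.val ∨ j.val + 1 = i.val) ∧
  (∀ j : Fin (2*k+1), x j ∈ I ↔ Odd j.val) ∧
  FreeVert G I (x 0) ∧ FreeVert G I (x (Fin.last (2*k)))


section TokenSliding

variable {V : Type} {G : SimpleGraph V}

theorem TSStep.symm {I J : Set V} (h : TSStep G I J) : TSStep G J I := by
  obtain ⟨hI, hJ, u, v, huv, hu, hv⟩ := h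
  exact ⟨hJ, hI, v, u, huv.symm, hv, hu⟩

theorem TSReach.symm {I J : Set V} (h : TSReach G I J) : TSReach G J I :=
  have : Std.Symm (TSStep G) := ⟨fun _ _ => TSStep.symm⟩
  Relation.ReflTransGen.stdSymm.symm _ _ h

theorem TSReach.indep {I J : Set V} (h : TSReach G I J) (hI : Indep G I) : Indep G J := by
  induction h with
  | refl => exact hI
  | tail _ h _ => exact h.2.1

theorem Indep.mono {s t : Set V} (h : Indep G t) (hst : s ⊆ t) : Indep G s :=
  fun u hu v hv => h u (hst hu) v (hst hv)

theorem Indep.insert {s : Set V} (h : Indep G s) {v : V} (hv : ∀ u ∈ s, ¬G.Adj v u) :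
    Indep G (insert v s) := by
  rintro a (rfl | ha) b (rfl | hb)
  · exact G.loopless.irrefl _
  · exact hv b hb
  · exact fun hab => hv a ha hab.symm
  · exact h a ha b hb

/-- In a claw-free graph a vertex has at most two neighbors in an independent set. -/
theorem ClawFree.eq_of_adj_indep (hcf : ClawFree G) {s : Set V} (hs : Indep G s) {v a b c : V}
    (ha : a ∈ s) (hb : b ∈ s) (hc : c ∈ s) (hva : G.Adj v a) (hvb : G.Adj v b)
    (hvc : G.Adj v c) (hab : a ≠ b) : c = a ∨ c = b := by
  by_contra! h
  exact hcf ⟨v, a, b, c, hva, hvb, hvc, hab, h.1.symm, h.2.symm,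
    hs a ha b hb, hs a ha c hc, hs b hb c hc⟩

theorem tsStep_insert {s : Set V} {u v : V} (huv : G.Adj u v) (hu : Indep G (insert u s))
    (hv : Indep G (insert v s)) (hus : u ∉ s) (hvs : v ∉ s) :
    TSStep G (insert u s) (insert v s) := by
  have hne := huv.ne
  refine ⟨hu, hv, u, v, huv, ?_, ?_⟩ <;> ext x <;> simp only [Set.mem_sdiff, Set.mem_insert_iff,
    Set.mem_singleton_iff] <;> grind

theorem TSStep.exists_insert {I J : Set V} (h : TSStep G I J) :
    ∃ (s : Set V) (u v : V), G.Adj u v ∧ u ∉ s ∧ v ∉ s ∧ I = insert u s ∧ J = insert v s := by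
  obtain ⟨-, -, u, v, huv, hu, hv⟩ := h
  have hu' := fun x => Set.ext_iff.1 hu x
  have hv' := fun x => Set.ext_iff.1 hv x
  simp only [Set.mem_sdiff, Set.mem_singleton_iff] at hu' hv'
  refine ⟨I ∩ J, u, v, huv, ?_, ?_, ?_, ?_⟩
  · grind
  · grind
  · ext x; simp only [Set.mem_insert_iff, Set.mem_inter_iff]; grind
  · ext x; simp only [Set.mem_insert_iff, Set.mem_inter_iff]; grind

theorem tsReach_of_path {s : Set V} (hs : Indep G s) (p : ℕ → V) (d : ℕ)
    (hadj : ∀ i < d, G.Adj (p i) (p (i + 1)))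
    (hp : ∀ i ≤ d, p i ∉ s ∧ ∀ r ∈ s, ¬G.Adj (p i) r) :
    TSReach G (insert (p 0) s) (insert (p d) s) := by
  induction d with
  | zero => exact .refl
  | succ d ih =>
    exact (ih (fun i hi => hadj i (by omega)) fun i hi => hp i (by omega)).tail <|
      tsStep_insert (hadj d (by omega)) (hs.insert (hp d (by omega)).2)
        (hs.insert (hp (d + 1) le_rfl).2) (hp d (by omega)).1 (hp (d + 1) le_rfl).1

/-- In a connected claw-free graph, the position of the hole in an independent set with one
token missing can be chosen freely. -/
theorem tsReach_diff_singleton (hconn : G.Connected) (hcf : ClawFree G) {X : Set V}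
    (hX : Indep G X) {x y : V} (hx : x ∈ X) (hy : y ∈ X) :
    TSReach G (X \ {y}) (X \ {x}) := by
  induction hd : G.dist x y using Nat.strong_induction_on generalizing x y with
  | _ d ih =>
  by_cases hz : ∃ z ∈ X, G.dist x z < d ∧ G.dist z y < d
  · obtain ⟨z, hzX, hxz, hzy⟩ := hz
    exact (ih _ hzy hzX hy rfl).trans (ih _ hxz hx hzX rfl)
  push Not at hz
  by_cases hxy : x = y
  · subst hxy; exact .refl
  obtain ⟨w, hw⟩ := hconn.exists_walk_length_eq_dist x y
  set p := w.getVert with hp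
  have hp0 : p 0 = x := w.getVert_zero
  have hpd : p d = y := by rw [← hd, ← hw]; exact w.getVert_length
  have hadj : ∀ i < d, G.Adj (p i) (p (i + 1)) := fun i hi => w.adj_getVert_succ (by omega)
  have hd1 : ∀ i, G.dist x (p i) ≤ i := fun i =>
    ((SimpleGraph.dist_le (w.take i)).trans (by simp))
  have hd2 : ∀ i, G.dist (p i) y ≤ d - i := fun i =>
    ((SimpleGraph.dist_le (w.drop i)).trans (by simp [hw, hd]))
  have htri : ∀ a b c, G.dist a c ≤ G.dist a b + G.dist b c := fun a b c => hconn.dist_triangle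
  have hone : ∀ a b, G.Adj a b → G.dist a b = 1 := fun a b h => SimpleGraph.dist_eq_one_iff_adj.2 h
  have hpX : ∀ i ≤ d, p i ∉ X \ {x, y} := by
    rintro i hi ⟨hiX, hixy⟩
    have h1 := hd1 i
    have h2 := hd2 i
    have h3 : i ≠ 0 := by rintro rfl; exact hixy (by simp [hp0])
    have h4 : i ≠ d := by rintro rfl; exact hixy (by simp [hpd])
    have := hz _ hiX (by omega)
    omega
  have hnear : ∀ i, 0 < i → i < d → ∀ z ∈ X \ {x, y}, ¬G.Adj (p i) z := by
    rintro i hi0 hid z ⟨hzX, hzxy⟩ hiz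
    simp only [Set.mem_insert_iff, Set.mem_singleton_iff, not_or] at hzxy
    obtain ⟨k, rfl⟩ : ∃ k, i = k + 1 := ⟨i - 1, by omega⟩
    have hzi := hone _ _ hiz.symm
    have hiz := hone _ _ hiz
    have a1 := htri x (p k) z
    have a2 := htri z (p (k + 1)) y
    have a3 := htri x (p (k + 1)) z
    have a4 := htri z (p (k + 2)) y
    have b1 := hd1 k
    have b2 := hd1 (k + 1)
    have b3 := hd2 (k + 1)
    have b4 := hd2 (k + 2)
    have hzz := hz z hzX
    have hkd : k + 1 + 1 ≤ d := by omega
    have hcl : (p k = z ∨ G.Adj (p k) z) ∨ (p (k + 2) = z ∨ G.Adj (p (k + 2)) z) := by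
      by_contra! hcon
      refine hcf ⟨p (k + 1), p k, p (k + 2), z, (hadj k (by omega)).symm, hadj (k + 1) hid,
        SimpleGraph.dist_eq_one_iff_adj.1 hiz, ?_, hcon.1.1, hcon.2.1, ?_, hcon.1.2, hcon.2.2⟩
      · intro he
        have := htri x (p k) y
        rw [he] at this b1
        omega
      · intro he
        have e1 := hone _ _ he
        have e2 := htri x (p k) (p (k + 2))
        have e3 := htri x (p (k + 2)) y
        omega
    rcases hcl with h | h
    · have hk : k ≠ 0 := by
        rintro rfl
        rw [hp0] at h
        rcases h with h | h
        · exact hzxy.1 h.symm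
        · exact hX _ hx _ hzX h
      have : G.dist (p k) z ≤ 1 := by
        rcases h with h | h
        · simp [h]
        · exact (hone _ _ h).le
      have := hzz (by omega)
      omega
    · have hk : k + 2 ≠ d := by
        rintro h'
        rw [h', hpd] at h
        rcases h with h | h
        · exact hzxy.2 h.symm
        · exact hX _ hy _ hzX h
      have : G.dist z (p (k + 2)) ≤ 1 := by
        rcases h with h | h
        · simp [h]
        · exact (hone _ _ h.symm).le
      have := hzz (by omega)
      omega
  have key := tsReach_of_path (hX.mono (Set.sdiff_subset (t := {x, y}))) p d hadj fun i hi => by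
    refine ⟨hpX i hi, ?_⟩
    rcases Nat.eq_zero_or_pos i with rfl | hi0
    · rw [hp0]; exact fun r hr => hX _ hx _ hr.1
    rcases hi.lt_or_eq with hid | rfl
    · exact hnear i hi0 hid
    · rw [hpd]; exact fun r hr => hX _ hy _ hr.1
  rw [hp0, hpd] at key
  have e1 : X \ {y} = insert x (X \ {x, y}) := by
    ext z; simp only [Set.mem_sdiff, Set.mem_insert_iff, Set.mem_singleton_iff]; grind
  have e2 : X \ {x} = insert y (X \ {x, y}) := by
    ext z; simp only [Set.mem_sdiff, Set.mem_insert_iff, Set.mem_singleton_iff]; grind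
  rwa [e1, e2]

theorem tsReach_jump (hconn : G.Connected) (hcf : ClawFree G) {I : Set V} (hI : Indep G I)
    {u v : V} (hu : u ∈ I) (hv : v ∉ I) (hvI : ∀ w ∈ I, ¬G.Adj v w) :
    TSReach G I (insert v (I \ {u})) := by
  have h := tsReach_diff_singleton hconn hcf (hI.insert hvI) (Set.mem_insert_of_mem v hu)
    (Set.mem_insert v I)
  have huv : v ≠ u := fun h => hv (h ▸ hu)
  have e1 : insert v I \ {v} = I := by
    ext z; simp only [Set.mem_sdiff, Set.mem_insert_iff, Set.mem_singleton_iff]; grind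
  have e2 : insert v I \ {u} = insert v (I \ {u}) := by
    ext z; simp only [Set.mem_sdiff, Set.mem_insert_iff, Set.mem_singleton_iff]; grind
  rwa [e1, e2] at h

theorem tsReach_insert_of_card_nbrs_le_one (hconn : G.Connected) (hcf : ClawFree G) {I J : Set V}
    (hI : Indep G I) (hJ : Indep G J) (hIJ : (I \ J).Nonempty) {v : V} (hvJ : v ∈ J) (hvI : v ∉ I)
    (hv : ∀ a ∈ I, ∀ b ∈ I, G.Adj v a → G.Adj v b → a = b) :
    ∃ u ∈ I \ J, TSReach G I (insert v (I \ {u})) := by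
  by_cases h : ∃ u ∈ I, G.Adj v u
  · obtain ⟨u, huI, hvu⟩ := h
    refine ⟨u, ⟨huI, fun huJ => hJ _ hvJ _ huJ hvu⟩, .single ?_⟩
    have e : I = insert u (I \ {u}) := (Set.insert_sdiff_self_of_mem huI).symm
    have hs : Indep G (I \ {u}) := hI.mono Set.sdiff_subset
    nth_rewrite 1 [e]
    refine tsStep_insert hvu.symm (e ▸ hI) (hs.insert fun w hw hvw => hw.2 ?_) (by simp)
      fun h => hvI h.1
    exact hv w hw.1 u huI hvw hvu
  · push Not at h
    obtain ⟨u, hu⟩ := hIJ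
    exact ⟨u, hu, tsReach_jump hconn hcf hI hu.1 hvI h⟩

theorem ZMod.even_val_add_one {n : ℕ} (hn : 2 ≤ n) (j : ZMod (2 * n)) :
    Even (j + 1).val ↔ ¬Even j.val := by
  have : NeZero (2 * n) := ⟨by omega⟩
  have : Fact (1 < 2 * n) := ⟨by omega⟩
  rw [ZMod.val_add, ZMod.val_one, Nat.even_iff, Nat.even_iff,
    Nat.mod_mod_of_dvd _ (Dvd.intro n rfl)]
  omega

theorem ZMod.add_one_ne_sub_one {n : ℕ} (hn : 2 ≤ n) (j : ZMod (2 * n)) : j + 1 ≠ j - 1 := by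
  intro h
  have h2 : ((2 : ℕ) : ZMod (2 * n)) = 0 := by
    push_cast
    linear_combination h
  rw [ZMod.natCast_eq_zero_iff] at h2
  exact absurd (Nat.le_of_dvd (by norm_num) h2) (by omega)

namespace IsBadCycle

variable {I : Set V} {n : ℕ} {c : ZMod (2 * n) → V}

theorem mem_add_one (h : IsBadCycle G I n c) (j : ZMod (2 * n)) : c (j + 1) ∈ I ↔ c j ∉ I := by
  rw [h.2.2.2.2, h.2.2.2.2, ZMod.even_val_add_one h.1]

theorem mem_sub_one (h : IsBadCycle G I n c) (j : ZMod (2 * n)) : c (j - 1) ∈ I ↔ c j ∉ I := by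
  have := h.mem_add_one (j - 1)
  rw [sub_add_cancel] at this
  tauto

theorem adj_sub_one (h : IsBadCycle G I n c) (j : ZMod (2 * n)) : G.Adj (c j) (c (j - 1)) := by
  simpa using (h.2.2.1 (j - 1)).symm

theorem apply_add_one_ne (h : IsBadCycle G I n c) (j : ZMod (2 * n)) : c (j + 1) ≠ c (j - 1) :=
  fun he => ZMod.add_one_ne_sub_one h.1 j (h.2.1 he)

theorem eq_of_adj (hcf : ClawFree G) (h : IsBadCycle G I n c) {L : Set V} (hL : Indep G L)
    {j : ZMod (2 * n)} (h1 : c (j + 1) ∈ L) (h2 : c (j - 1) ∈ L) {r : V} (hr : r ∈ L)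
    (hadj : G.Adj (c j) r) : r = c (j + 1) ∨ r = c (j - 1) :=
  hcf.eq_of_adj_indep hL h1 h2 hr (h.2.2.1 j) (h.adj_sub_one j) hadj (h.apply_add_one_ne j)

theorem indep_symmDiff (hcf : ClawFree G) (hI : Indep G I) (h : IsBadCycle G I n c) :
    Indep G (symmDiff I (Set.range c)) := by
  have key : ∀ j, c j ∉ I → ∀ r ∈ I, r ∉ Set.range c → ¬G.Adj (c j) r := by
    intro j hj r hr hrc hadj
    rcases h.eq_of_adj hcf hI ((h.mem_add_one j).2 hj) ((h.mem_sub_one j).2 hj) hr hadj with e | e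
    · exact hrc ⟨_, e.symm⟩
    · exact hrc ⟨_, e.symm⟩
  rintro a (⟨haI, hac⟩ | ⟨⟨j, rfl⟩, haI⟩) b (⟨hbI, hbc⟩ | ⟨⟨k, rfl⟩, hbI⟩) hab
  · exact hI _ haI _ hbI hab
  · exact key k hbI a haI hac hab.symm
  · exact key j haI b hbI hbc hab
  · rcases h.2.2.2.1 j k hab with rfl | rfl
    · exact hbI ((h.mem_add_one _).2 haI)
    · exact haI ((h.mem_add_one _).2 hbI)

theorem ncard_symmDiff [Finite V] (h : IsBadCycle G I n c) :
    (symmDiff I (Set.range c)).ncard = I.ncard := by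
  have hmem : ∀ j, c j ∈ I ↔ c (j + 1) ∉ I := fun j => by rw [h.mem_add_one]; tauto
  have e : (Set.range c \ I).ncard = (I ∩ Set.range c).ncard := by
    have e1 : Set.range c \ I = c '' {j | c j ∉ I} := by ext; simp; grind
    have e2 : I ∩ Set.range c = c '' ((· + 1) '' {j | c j ∉ I}) := by
      ext x
      simp only [Set.mem_inter_iff, Set.mem_range, Set.mem_image, Set.mem_ofPred_eq]
      constructor
      · rintro ⟨hx, j, rfl⟩
        exact ⟨j, ⟨j - 1, by rw [h.mem_sub_one]; tauto, by simp⟩, rfl⟩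
      · rintro ⟨_, ⟨j, hj, rfl⟩, rfl⟩
        exact ⟨(h.mem_add_one j).2 hj, _, rfl⟩
    rw [e1, e2, Set.ncard_image_of_injective _ h.2.1, Set.ncard_image_of_injective _ h.2.1,
      Set.ncard_image_of_injective _ (add_left_injective 1)]
  rw [Set.symmDiff_def, Set.ncard_union_eq
    (Set.disjoint_left.2 fun x hx hx' => hx'.2 hx.1) (Set.toFinite _) (Set.toFinite _), e,
    add_comm, Set.ncard_inter_add_ncard_sdiff_eq_ncard _ _ (Set.toFinite _)]

theorem of_mem_iff {K : Set V} (h : IsBadCycle G I n c) (hK : ∀ j, c j ∈ I ↔ c j ∈ K) :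
    IsBadCycle G K n c :=
  ⟨h.1, h.2.1, h.2.2.1, h.2.2.2.1, fun j => (hK j).symm.trans (h.2.2.2.2 j)⟩

/-- Moving a token of a bad cycle away from one of its two cycle neighbors destroys all cycles
in the symmetric difference with the flipped cycle. -/
theorem not_badCycle_of_slide (hcf : ClawFree G) {s : Set V} {k : ZMod (2 * n)} {v : V}
    (hI : Indep G (insert (c k) s)) (hks : c k ∉ s)
    (h : IsBadCycle G (insert (c k) s) n c)
    (hv : ¬(G.Adj v (c (k + 1)) ∧ G.Adj v (c (k - 1)))) {m : ℕ} {d : ZMod (2 * m) → V}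
    (hd : IsBadCycle G (insert v s) m d) (hK : Indep G (insert v s)) :
    ¬Set.range d ⊆ symmDiff (insert v s) (symmDiff (insert (c k) s) (Set.range c)) := by
  intro hsub
  have : NeZero (2 * n) := ⟨by have := h.1; omega⟩
  set I := insert (c k) s
  set K := insert v s
  set L := symmDiff I (Set.range c) with hLdef
  have hL : Indep G L := h.indep_symmDiff hcf hI
  have hkI : c k ∈ I := Set.mem_insert _ _
  have hdL : ∀ j, d j ∈ K ↔ d j ∉ L := by
    intro j
    have := hsub ⟨j, rfl⟩
    rw [Set.mem_symmDiff] at this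
    exact ⟨fun h1 h2 => by rcases this with t | t <;> [exact t.2 h2; exact t.2 h1],
      fun h1 => (this.resolve_right fun t => h1 t.1).1⟩
  have hcL : ∀ y, c y ∈ L ↔ c y ∉ I := by
    intro y
    simp [hLdef, Set.mem_symmDiff]
  have hcs : ∀ y, y ≠ k → c y ∈ I → c y ∈ s := by
    rintro y hy (hc | hc)
    · exact absurd (h.2.1 hc) hy
    · exact hc
  have hclos : ∀ x ∈ Set.range d, ∀ y, G.Adj x y → (x ∈ K → y ∈ L) → (x ∉ K → y ∈ K) →
      y ∈ Set.range d := by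
    rintro _ ⟨j, rfl⟩ y hxy h1 h2
    by_cases hj : d j ∈ K
    · rcases hd.eq_of_adj hcf hL (j := j)
        (by by_contra hc; exact (hd.mem_add_one j).1 ((hdL _).2 hc) hj)
        (by by_contra hc; exact (hd.mem_sub_one j).1 ((hdL _).2 hc) hj) (h1 hj) hxy with e | e
      · exact ⟨_, e.symm⟩
      · exact ⟨_, e.symm⟩
    · rcases hd.eq_of_adj hcf hK ((hd.mem_add_one j).2 hj) ((hd.mem_sub_one j).2 hj) (h2 hj) hxy
        with e | e
      · exact ⟨_, e.symm⟩
      · exact ⟨_, e.symm⟩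
  have hnext : ∀ y z, y ≠ k → z ≠ k → G.Adj (c y) (c z) → (c z ∈ I ↔ c y ∉ I) →
      c y ∈ Set.range d → c z ∈ Set.range d := by
    intro y z hy hz hadj hyz hyd
    refine hclos _ hyd _ hadj (fun hyK => ?_) fun hyK => ?_
    · obtain ⟨j, hj⟩ := hyd
      rw [hcL, hyz, not_not]
      by_contra hc
      have := (hdL j).1 (hj ▸ hyK)
      rw [hj, hcL] at this
      exact this hc
    · refine Set.mem_insert_of_mem _ (hcs z hz (hyz.2 fun hyI => hyK ?_))
      exact Set.mem_insert_of_mem _ (hcs y hy hyI)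
  have hne : ∀ t : ℕ, 1 ≤ t → t < 2 * n → k + (t : ZMod (2 * n)) ≠ k := by
    intro t ht1 ht2 he
    rw [add_eq_left, ZMod.natCast_eq_zero_iff] at he
    exact absurd (Nat.le_of_dvd ht1 he) (by omega)
  have hup : ∀ t : ℕ, 1 ≤ t → t + 1 < 2 * n →
      (c (k + (t : ZMod (2 * n))) ∈ Set.range d ↔
        c (k + ((t + 1 : ℕ) : ZMod (2 * n))) ∈ Set.range d) := by
    intro t ht1 ht2
    have e : k + ((t + 1 : ℕ) : ZMod (2 * n)) = k + (t : ZMod (2 * n)) + 1 := by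
      push_cast; ring
    have hn1 := hne t ht1 (by omega)
    have hn2 := hne (t + 1) (by omega) ht2
    rw [e] at hn2 ⊢
    have ha := h.2.2.1 (k + (t : ZMod (2 * n)))
    have hm := h.mem_add_one (k + (t : ZMod (2 * n)))
    exact ⟨hnext _ _ hn1 hn2 ha hm, hnext _ _ hn2 hn1 ha.symm (by tauto)⟩
  have hall : ∀ t : ℕ, 1 ≤ t → t < 2 * n →
      (c (k + (t : ZMod (2 * n))) ∈ Set.range d ↔ c (k + 1) ∈ Set.range d) := by
    intro t ht1
    induction t, ht1 using Nat.le_induction with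
    | base => intro _; simp
    | succ t ht1 ih => intro ht2; rw [← hup t ht1 ht2]; exact ih (by omega)
  obtain ⟨j, hj⟩ : ∃ j, d j ∉ K := by
    by_cases h0 : d 0 ∈ K
    · exact ⟨0 + 1, fun hc => (hd.mem_add_one 0).1 hc h0⟩
    · exact ⟨0, h0⟩
  have hjL : d j ∈ L := by by_contra hc; exact hj ((hdL j).2 hc)
  obtain ⟨y, hy⟩ : d j ∈ Set.range c := by
    by_contra hc
    rcases hjL with ⟨hjI | hjI, -⟩ | ⟨hjc, -⟩
    · exact hc ⟨k, hjI.symm⟩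
    · exact hj (Set.mem_insert_of_mem _ hjI)
    · exact hc hjc
  have hyk : y ≠ k := by
    rintro rfl
    rw [← hy, hcL] at hjL
    exact hjL hkI
  have hcyc : ∀ z, z ≠ k → (c z ∈ Set.range d ↔ c (k + 1) ∈ Set.range d) := by
    intro z hz
    have hz' : z - k ≠ 0 := sub_ne_zero.2 hz
    have := hall (z - k).val (Nat.one_le_iff_ne_zero.2 (by simpa using hz'))
      (ZMod.val_lt _)
    simpa using this
  have hk1 : c (k + 1) ∈ Set.range d := (hcyc y hyk).1 ⟨j, hy.symm⟩
  have hkn : k - 1 ≠ k := by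
    intro hc
    exact (h.mem_sub_one k).1 (hc.symm ▸ hkI) hkI
  have hk2 : c (k - 1) ∈ Set.range d := (hcyc _ hkn).2 hk1
  have hfin : ∀ z z', c z ∈ Set.range d → c z ∉ I → (∀ r ∈ I, G.Adj (c z) r → r = c k ∨ r = z') →
      G.Adj v (c z) := by
    rintro z z' ⟨i, hi⟩ hzI hz
    by_contra hvz
    have hiK : d i ∉ K := by
      rw [hdL, not_not, hi, hcL]
      exact hzI
    have hr : ∀ r ∈ K, G.Adj (c z) r → r = z' := by
      rintro r (rfl | hr) hadj
      · exact absurd hadj.symm hvz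
      · exact (hz r (Set.mem_insert_of_mem _ hr) hadj).resolve_left fun e => hks (e ▸ hr)
    exact hd.apply_add_one_ne i <|
      (hr _ ((hd.mem_add_one i).2 hiK) (hi ▸ hd.2.2.1 i)).trans
        (hr _ ((hd.mem_sub_one i).2 hiK) (hi ▸ hd.adj_sub_one i)).symm
  have hI1 : c (k + 1) ∉ I := fun hc => (h.mem_add_one k).1 hc hkI
  have hI2 : c (k - 1) ∉ I := fun hc => (h.mem_sub_one k).1 hc hkI
  refine hv ⟨hfin _ (c (k + 1 + 1)) hk1 hI1 fun r hr hadj => ?_,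
    hfin _ (c (k - 1 - 1)) hk2 hI2 fun r hr hadj => ?_⟩
  · have := h.eq_of_adj hcf hI ((h.mem_add_one _).2 hI1) ((h.mem_sub_one _).2 hI1) hr hadj
    rw [add_sub_cancel_right] at this
    exact this.symm
  · have := h.eq_of_adj hcf hI ((h.mem_add_one _).2 hI2) ((h.mem_sub_one _).2 hI2) hr hadj
    rwa [sub_add_cancel] at this

theorem update (hcf : ClawFree G) {s : Set V} {k : ZMod (2 * n)} {v : V}
    (hK : Indep G (insert v s)) (hvI : v ∉ insert (c k) s)
    (h : IsBadCycle G (insert (c k) s) n c)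
    (h1 : G.Adj v (c (k + 1))) (h2 : G.Adj v (c (k - 1))) :
    IsBadCycle G (insert v s) n (Function.update c k v) := by
  have hcs : ∀ y, y ≠ k → (c y ∈ insert (c k) s ↔ c y ∈ s) := fun y hy => by
    simp [h.2.1.ne hy]
  have hkI : c k ∈ insert (c k) s := Set.mem_insert _ _
  have hvadj : ∀ y, y ≠ k → G.Adj v (c y) → y = k + 1 ∨ k = y + 1 := by
    intro y hyk hvy
    have hyI : c y ∉ insert (c k) s := fun hc =>
      hK _ (Set.mem_insert _ _) _ (Set.mem_insert_of_mem _ ((hcs y hyk).1 hc)) hvy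
    by_contra! hc
    have e1 := (hcs (y + 1) hc.2.symm).1 ((h.mem_add_one y).2 hyI)
    have e2 := (hcs (y - 1) (fun e => hc.1 (by rw [← e]; ring))).1 ((h.mem_sub_one y).2 hyI)
    rcases h.eq_of_adj hcf hK (Set.mem_insert_of_mem _ e1) (Set.mem_insert_of_mem _ e2)
      (Set.mem_insert _ _) hvy.symm with e | e
    · exact hvI (e ▸ Set.mem_insert_of_mem _ e1)
    · exact hvI (e ▸ Set.mem_insert_of_mem _ e2)
  have hvc : ∀ y, y ≠ k → c y ≠ v := by
    intro y hy he
    by_cases hyI : c y ∈ insert (c k) s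
    · exact hvI (he ▸ hyI)
    · have ha := h.2.2.1 y
      have hb := h.adj_sub_one y
      rw [he] at ha hb
      have e1 : y + 1 = k := by
        by_contra hc
        exact hK _ (Set.mem_insert _ _) _
          (Set.mem_insert_of_mem _ ((hcs _ hc).1 ((h.mem_add_one y).2 hyI))) ha
      have e2 : y - 1 = k := by
        by_contra hc
        exact hK _ (Set.mem_insert _ _) _
          (Set.mem_insert_of_mem _ ((hcs _ hc).1 ((h.mem_sub_one y).2 hyI))) hb
      exact ZMod.add_one_ne_sub_one h.1 y (e1.trans e2.symm)
  have hk1 : k + 1 ≠ k := fun e => (h.mem_add_one k).1 (e.symm ▸ hkI) hkI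
  refine ⟨h.1, ?_, ?_, ?_, ?_⟩
  · intro i j hij
    by_cases hi : i = k <;> by_cases hj : j = k
    · rw [hi, hj]
    · rw [hi, Function.update_self, Function.update_of_ne hj] at hij
      exact absurd hij.symm (hvc j hj)
    · rw [hj, Function.update_self, Function.update_of_ne hi] at hij
      exact absurd hij (hvc i hi)
    · rw [Function.update_of_ne hi, Function.update_of_ne hj] at hij
      exact h.2.1 hij
  · intro j
    by_cases hj : j = k
    · rw [hj, Function.update_self, Function.update_of_ne hk1]
      exact h1
    · by_cases hj' : j + 1 = k
      · rw [hj', Function.update_self, Function.update_of_ne hj, show j = k - 1 by rw [← hj']; ring]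
        exact h2.symm
      · rw [Function.update_of_ne hj, Function.update_of_ne hj']
        exact h.2.2.1 j
  · intro i j hij
    by_cases hi : i = k <;> by_cases hj : j = k
    · rw [hi, hj] at hij
      exact absurd hij (G.loopless.irrefl _)
    · rw [hi, Function.update_self, Function.update_of_ne hj] at hij
      rw [hi]
      exact hvadj j hj hij
    · rw [hj, Function.update_self, Function.update_of_ne hi] at hij
      rw [hj]
      exact (hvadj i hi hij.symm).symm
    · rw [Function.update_of_ne hi, Function.update_of_ne hj] at hij
      exact h.2.2.2.1 i j hij
  · intro j
    rw [← h.2.2.2.2]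
    by_cases hj : j = k
    · rw [hj, Function.update_self]
      exact ⟨fun _ => hkI, fun _ => Set.mem_insert _ _⟩
    · rw [Function.update_of_ne hj, hcs j hj, Set.mem_insert_iff, or_iff_right (hvc j hj)]

theorem range_update (h : IsBadCycle G I n c) (k : ZMod (2 * n)) (v : V) :
    Set.range (Function.update c k v) = insert v (Set.range c \ {c k}) := by
  ext x
  constructor
  · rintro ⟨j, rfl⟩
    by_cases hj : j = k
    · rw [hj, Function.update_self]
      exact Set.mem_insert _ _
    · rw [Function.update_of_ne hj]
      exact Or.inr ⟨⟨j, rfl⟩, h.2.1.ne hj⟩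
  · rintro (rfl | ⟨⟨j, rfl⟩, hj⟩)
    · exact ⟨k, Function.update_self _ _ _⟩
    · exact ⟨j, Function.update_of_ne (fun e => hj (by rw [e]; rfl)) _ _⟩

end IsBadCycle

theorem SimpleGraph.not_isAcyclic_of_forall_adj_exists_ne {W : Type*} [Finite W]
    {H : SimpleGraph W} {x y : W} (hxy : H.Adj x y)
    (h : ∀ a b, H.Adj a b → ∃ z, z ≠ b ∧ H.Adj a z) : ¬H.IsAcyclic := by
  have := Fintype.ofFinite W
  intro hac
  have hlong : ∀ k : ℕ, ∃ (a b : W) (p : H.Walk a b), p.IsPath ∧ p.length = k + 1 := by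
    intro k
    induction k with
    | zero =>
      exact ⟨x, y, hxy.toWalk, by simp [hxy.ne], rfl⟩
    | succ k ih =>
      obtain ⟨a, b, p, hp, hpk⟩ := ih
      have hnil : ¬p.Nil := by
        rw [← SimpleGraph.Walk.length_eq_zero_iff]
        omega
      obtain ⟨z, hz, hbz⟩ := h _ _ (p.adj_penultimate hnil).symm
      have hzs : z ∉ p.support := fun hc => hz (hac.eq_penultimate_of_adj_end hp hbz hc)
      exact ⟨a, z, p.concat hbz, hp.concat hzs hbz, by simp [hpk]⟩
  obtain ⟨a, b, p, hp, hpk⟩ := hlong (Fintype.card W)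
  have := hp.length_lt
  omega

theorem SimpleGraph.cycleGraph_isContained_iff_exists_zmod {W : Type*} {H : SimpleGraph W} {N : ℕ}
    (hN : 3 ≤ N) : (SimpleGraph.cycleGraph N).IsContained H ↔
      ∃ c : ZMod N → W, Function.Injective c ∧ ∀ j, H.Adj (c j) (c (j + 1)) := by
  obtain ⟨N, rfl⟩ : ∃ k, N = k + 3 := ⟨N - 3, by omega⟩
  constructor
  · rintro ⟨f⟩
    refine ⟨f, f.injective, fun j => f.toHom.map_adj ?_⟩
    exact SimpleGraph.cycleGraph_adj.2 (Or.inr (add_sub_cancel_left (G := ZMod (N + 3)) j 1))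
  · rintro ⟨c, hc, hadj⟩
    refine ⟨⟨⟨c, fun {a b} hab => ?_⟩, hc⟩⟩
    rcases SimpleGraph.cycleGraph_adj.1 hab with h | h
    · have e : a = b + 1 := (sub_eq_iff_eq_add' (G := ZMod (N + 3))).1 h
      rw [e]
      exact (hadj b).symm
    · have e : b = a + 1 := (sub_eq_iff_eq_add' (G := ZMod (N + 3))).1 h
      rw [e]
      exact hadj a

theorem IsBadCycle.not_isAcyclic {I : Set V} {n : ℕ} {c : ZMod (2 * n) → V}
    (h : IsBadCycle G I n c) {s : Set V} (hs : Set.range c ⊆ s) : ¬(G.induce s).IsAcyclic := by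
  have hn : 3 ≤ 2 * n := by have := h.1; omega
  intro hac
  refine SimpleGraph.isAcyclic_iff_free_cycleGraph.1 hac _ hn
    ((SimpleGraph.cycleGraph_isContained_iff_exists_zmod hn).2
      ⟨fun j => ⟨c j, hs ⟨j, rfl⟩⟩, fun i j hij => h.2.1 (by simpa using hij), fun j => ?_⟩)
  simpa using h.2.2.1 j

theorem exists_two_nbrs_of_exists_two_nbrs [Finite V] (hcf : ClawFree G) {S T : Set V}
    (hT : Indep G T) (hST : Disjoint S T) (hcard : S.ncard = T.ncard)
    (h : ∀ v ∈ T, ∃ a ∈ S, ∃ b ∈ S, a ≠ b ∧ G.Adj v a ∧ G.Adj v b) :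
    ∀ u ∈ S, ∃ a ∈ T, ∃ b ∈ T, a ≠ b ∧ G.Adj u a ∧ G.Adj u b := by
  classical
  have := Fintype.ofFinite V
  have hH := SimpleGraph.between_isBipartiteWith (G := G) hST
  set H := G.between S T
  have hsum := SimpleGraph.isBipartiteWith_sum_degrees_eq (G := H) (s := S.toFinset)
    (t := T.toFinset) (by simpa using hH)
  have hle : ∀ {B : Set V}, Indep G B → ∀ u, (∀ w, H.Adj u w → w ∈ B) → H.degree u ≤ 2 := by
    intro B hB u hu
    by_contra! hc
    rw [← SimpleGraph.card_neighborFinset_eq_degree, Finset.two_lt_card] at hc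
    obtain ⟨a, ha, b, hb, c, hc, hab, hac, hbc⟩ := hc
    rw [SimpleGraph.mem_neighborFinset] at ha hb hc
    rcases hcf.eq_of_adj_indep hB (hu a ha) (hu b hb) (hu c hc) ha.1 hb.1 hc.1 hab with e | e
    · exact hac e.symm
    · exact hbc e.symm
  have hT2 : ∀ v ∈ T.toFinset, 2 ≤ H.degree v := by
    intro v hv
    rw [Set.mem_toFinset] at hv
    obtain ⟨a, ha, b, hb, hab, hva, hvb⟩ := h v hv
    rw [← SimpleGraph.card_neighborFinset_eq_degree, ← Nat.lt_iff_add_one_le,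
      Finset.one_lt_card]
    exact ⟨a, by simpa using ⟨hva, Or.inr ⟨hv, ha⟩⟩, b, by simpa using ⟨hvb, Or.inr ⟨hv, hb⟩⟩, hab⟩
  have hS2 : ∀ u ∈ S.toFinset, H.degree u ≤ 2 := by
    intro u hu
    rw [Set.mem_toFinset] at hu
    exact hle hT u fun w hw => hH.mem_of_mem_adj hu hw
  have hge : ∑ u ∈ S.toFinset, 2 ≤ ∑ u ∈ S.toFinset, H.degree u := by
    rw [hsum]
    refine le_trans (le_of_eq ?_) (Finset.sum_le_sum hT2)
    rw [Finset.sum_const, Finset.sum_const, ← Set.ncard_eq_toFinset_card',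
      ← Set.ncard_eq_toFinset_card', hcard]
  have heq := (Finset.sum_eq_sum_iff_of_le hS2).1 (le_antisymm (Finset.sum_le_sum hS2) hge)
  intro u hu
  have h2 := heq u (by simpa using hu)
  have h2 : 1 < (H.neighborFinset u).card := by
    rw [SimpleGraph.card_neighborFinset_eq_degree, h2]
    norm_num
  obtain ⟨a, ha, b, hb, hab⟩ := Finset.one_lt_card.1 h2
  rw [SimpleGraph.mem_neighborFinset] at ha hb
  exact ⟨a, hH.mem_of_mem_adj hu ha, b, hH.mem_of_mem_adj hu hb, hab, ha.1, hb.1⟩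

/-- A cycle of `ZMod N` alternating between a set and its complement has even length. -/
theorem ZMod.even_of_alternating {N : ℕ} [NeZero N] {p : ZMod N → Prop}
    (hp : ∀ j, p (j + 1) ↔ ¬p j) : Even N ∧ (p 0 → ∀ j, p j ↔ Even j.val) := by
  have key : ∀ t : ℕ, p (t : ZMod N) ↔ (p 0 ↔ Even t) := by
    intro t
    induction t with
    | zero => simp
    | succ t ih =>
      push_cast
      rw [hp, ih, Nat.even_add_one]
      tauto
  refine ⟨?_, fun h0 j => ?_⟩
  · have := key N
    simp only [CharP.cast_eq_zero] at this
    tauto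
  · have := key j.val
    rw [ZMod.natCast_zmod_val] at this
    tauto

theorem exists_badCycle [Finite V] (hcf : ClawFree G) {I J : Set V} (hI : Indep G I)
    (hJ : Indep G J) (hcard : I.ncard = J.ncard) (hne : (J \ I).Nonempty)
    (h : ∀ v ∈ J \ I, ∃ a ∈ I, ∃ b ∈ I, a ≠ b ∧ G.Adj v a ∧ G.Adj v b) :
    ∃ (n : ℕ) (c : ZMod (2 * n) → V), IsBadCycle G I n c ∧ Set.range c ⊆ symmDiff I J := by
  have hdisj : Disjoint (I \ J) (J \ I) := Set.disjoint_left.2 fun x hx hx' => hx.2 hx'.1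
  have hcard' : (I \ J).ncard = (J \ I).ncard := by
    have e1 := Set.ncard_inter_add_ncard_sdiff_eq_ncard I J (Set.toFinite _)
    have e2 := Set.ncard_inter_add_ncard_sdiff_eq_ncard J I (Set.toFinite _)
    rw [Set.inter_comm] at e2
    omega
  have hnot : ∀ v ∈ J, ∀ a, G.Adj v a → a ∉ J := fun v hv a hva haJ => hJ v hv a haJ hva
  have hT : ∀ v ∈ J \ I, ∃ a ∈ I \ J, ∃ b ∈ I \ J, a ≠ b ∧ G.Adj v a ∧ G.Adj v b := by
    intro v hv
    obtain ⟨a, ha, b, hb, hab, hva, hvb⟩ := h v hv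
    exact ⟨a, ⟨ha, hnot v hv.1 a hva⟩, b, ⟨hb, hnot v hv.1 b hvb⟩, hab, hva, hvb⟩
  have hS := exists_two_nbrs_of_exists_two_nbrs hcf
    (hJ.mono Set.sdiff_subset) hdisj hcard' hT
  have hac : ¬(G.between (I \ J) (J \ I)).IsAcyclic := by
    obtain ⟨v, hv⟩ := hne
    obtain ⟨a, ha, -, -, -, hva, -⟩ := hT v hv
    refine SimpleGraph.not_isAcyclic_of_forall_adj_exists_ne (x := v) (y := a)
      ⟨hva, Or.inr ⟨hv, ha⟩⟩ ?_
    rintro x y ⟨hxy, ⟨hx, hy⟩ | ⟨hx, hy⟩⟩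
    · obtain ⟨a, ha, b, hb, hab, hxa, hxb⟩ := hS x hx
      by_cases hya : a = y
      · exact ⟨b, by rw [← hya]; exact hab.symm, hxb, Or.inl ⟨hx, hb⟩⟩
      · exact ⟨a, hya, hxa, Or.inl ⟨hx, ha⟩⟩
    · obtain ⟨a, ha, b, hb, hab, hxa, hxb⟩ := hT x hx
      by_cases hya : a = y
      · exact ⟨b, by rw [← hya]; exact hab.symm, hxb, Or.inr ⟨hx, hb⟩⟩
      · exact ⟨a, hya, hxa, Or.inr ⟨hx, ha⟩⟩
  rw [SimpleGraph.isAcyclic_iff_free_cycleGraph] at hac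
  push Not at hac
  obtain ⟨N, hN, hcon⟩ := hac
  obtain ⟨c₀, hinj₀, hadj₀⟩ := (SimpleGraph.cycleGraph_isContained_iff_exists_zmod hN).1 hcon
  have : NeZero N := ⟨by omega⟩
  obtain ⟨c, hinj, hadj, hc0⟩ : ∃ c : ZMod N → V, Function.Injective c ∧
      (∀ j, (G.between (I \ J) (J \ I)).Adj (c j) (c (j + 1))) ∧ c 0 ∈ I := by
    rcases (hadj₀ 0).2 with h | h
    · exact ⟨c₀, hinj₀, hadj₀, h.1.1⟩
    · exact ⟨fun j => c₀ (j + 1), hinj₀.comp (add_left_injective 1), fun j => hadj₀ (j + 1),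
        h.2.1⟩
  obtain ⟨⟨n, hn⟩, hpar⟩ := ZMod.even_of_alternating (p := fun j => c j ∈ I) fun j => by
    rcases (hadj j).2 with h | h
    · exact iff_of_false h.2.2 (not_not.2 h.1.1)
    · exact iff_of_true h.2.1 h.1.2
  rw [← two_mul] at hn
  subst hn
  have hsub : Set.range c ⊆ symmDiff I J := by
    rintro _ ⟨j, rfl⟩
    rcases (hadj j).2 with h | h
    · exact Or.inl h.1
    · exact Or.inr h.1
  have hn : 2 ≤ n := by omega
  refine ⟨n, c, ⟨hn, hinj, fun j => (hadj j).1, fun i j hij => ?_, hpar hc0⟩, hsub⟩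
  have hne' : c (i + 1) ≠ c (i - 1) := fun he => ZMod.add_one_ne_sub_one hn i (hinj he)
  have h1 := hadj i
  have h2 := (hadj (i - 1)).symm
  rw [sub_add_cancel] at h2
  have key : c j = c (i + 1) ∨ c j = c (i - 1) := by
    have hj := hsub ⟨j, rfl⟩
    rcases h1.2 with ⟨hi, hi1⟩ | ⟨hi, hi1⟩
    · have hi2 := (h2.2.resolve_right fun t => t.1.2 hi.1).2
      have hjJ : c j ∈ J := (hj.resolve_left fun t => hI _ hi.1 _ t.1 hij).1
      exact hcf.eq_of_adj_indep hJ hi1.1 hi2.1 hjJ h1.1 h2.1 hij hne'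
    · have hi2 := (h2.2.resolve_left fun t => hi.2 t.1.1).2
      have hjI : c j ∈ I := (hj.resolve_right fun t => hJ _ hi.1 _ t.1 hij).1
      exact hcf.eq_of_adj_indep hI hi1.1 hi2.1 hjI h1.1 h2.1 hij hne'
  rcases key with e | e
  · exact Or.inl (hinj e)
  · exact Or.inr (by rw [hinj e]; ring)

/-- If every bad cycle in `G[I △ J]` satisfies a reconfiguration-invariant property that allows to
flip it, then `J` can be reached from `I`. -/
theorem tsReach_of_forall_badCycle [Finite V] (hconn : G.Connected) (hcf : ClawFree G)
    (Q : Set V → (n : ℕ) → (ZMod (2 * n) → V) → Prop)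
    (hQ : ∀ I I' n c, TSReach G I I' → Q I n c → Q I' n c)
    (hflip : ∀ I n c, Indep G I → IsBadCycle G I n c → Q I n c →
      TSReach G I (symmDiff I (Set.range c)))
    {I J : Set V} (hI : Indep G I) (hJ : Indep G J) (hcard : I.ncard = J.ncard)
    (h : ∀ n c, IsBadCycle G I n c → Set.range c ⊆ symmDiff I J → Q I n c) : TSReach G I J := by
  induction hd : (I \ J).ncard using Nat.strong_induction_on generalizing I with
  | _ d ih =>
  have hcard' : (I \ J).ncard = (J \ I).ncard := by
    have e1 := Set.ncard_inter_add_ncard_sdiff_eq_ncard I J (Set.toFinite _)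
    have e2 := Set.ncard_inter_add_ncard_sdiff_eq_ncard J I (Set.toFinite _)
    rw [Set.inter_comm] at e2
    omega
  rcases (I \ J).eq_empty_or_nonempty with hemp | hne
  · rw [Set.eq_of_subset_of_ncard_le (Set.sdiff_eq_empty.1 hemp) hcard.ge (Set.toFinite _)]
    exact .refl
  have hne' : (J \ I).Nonempty := by
    rw [← Set.ncard_pos (Set.toFinite _), ← hcard', Set.ncard_pos (Set.toFinite _)]
    exact hne
  have step : ∀ I₁, TSReach G I I₁ → I₁.ncard = J.ncard → (I₁ \ J).ncard < d →
      (∀ x ∈ symmDiff I₁ J, x ∈ symmDiff I J ∧ (x ∈ I₁ ↔ x ∈ I)) → TSReach G I J := by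
    intro I₁ hr hc hlt hx
    refine hr.trans (ih _ hlt (hr.indep hI) hc (fun n c hb hcr => ?_) rfl)
    exact hQ _ _ _ _ hr (h n c (hb.of_mem_iff fun j => (hx _ (hcr ⟨j, rfl⟩)).2)
      fun x hxc => (hx x (hcr hxc)).1)
  by_cases hfree : ∃ v ∈ J \ I, ∀ a ∈ I, ∀ b ∈ I, G.Adj v a → G.Adj v b → a = b
  · obtain ⟨v, hv, hvn⟩ := hfree
    obtain ⟨u, hu, hr⟩ := tsReach_insert_of_card_nbrs_le_one hconn hcf hI hJ hne hv.1 hv.2 hvn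
    have hvu : v ≠ u := fun e => hv.2 (e ▸ hu.1)
    refine step _ hr ?_ ?_ ?_
    · rw [Set.ncard_insert_of_notMem (fun t => hv.2 t.1) (Set.toFinite _),
        Set.ncard_sdiff_singleton_add_one hu.1 (Set.toFinite _), hcard]
    · rw [← hd]
      refine Set.ncard_lt_ncard ?_ (Set.toFinite _)
      refine Set.ssubset_iff_of_subset ?_ |>.2 ⟨u, hu, ?_⟩
      · rintro x ⟨rfl | hx, hxJ⟩
        · exact absurd hv.1 hxJ
        · exact ⟨hx.1, hxJ⟩
      · rintro ⟨e | hx, -⟩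
        · exact hvu e.symm
        · exact hx.2 rfl
    · rintro x (⟨rfl | hx, hxJ⟩ | ⟨hxJ, hx⟩)
      · exact absurd hv.1 hxJ
      · exact ⟨Or.inl ⟨hx.1, hxJ⟩, iff_of_true (Or.inr hx) hx.1⟩
      · have hxI : x ∉ I := fun hxI => hx (Or.inr ⟨hxI, fun e => hu.2 (e ▸ hxJ)⟩)
        exact ⟨Or.inr ⟨hxJ, hxI⟩, iff_of_false hx hxI⟩
  · push Not at hfree
    obtain ⟨n, c, hb, hcr⟩ := exists_badCycle hcf hI hJ hcard hne' fun v hv => by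
      obtain ⟨a, ha, b, hb, hva, hvb, hab⟩ := hfree v hv
      exact ⟨a, ha, b, hb, hab, hva, hvb⟩
    have hmem : ∀ x ∈ symmDiff (symmDiff I (Set.range c)) J, x ∉ Set.range c := by
      intro x hx hxc
      have := hcr hxc
      simp only [Set.mem_symmDiff] at hx this
      grind
    refine step _ (hflip I n c hI hb (h n c hb hcr)) (hb.ncard_symmDiff.trans hcard) ?_ ?_
    · rw [← hd]
      refine Set.ncard_lt_ncard ?_ (Set.toFinite _)
      obtain ⟨j, hj⟩ : ∃ j, c j ∈ I := by
        by_cases h0 : c 0 ∈ I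
        · exact ⟨_, h0⟩
        · exact ⟨_, (hb.mem_add_one 0).2 h0⟩
      have hjJ : c j ∉ J := by
        rcases hcr ⟨j, rfl⟩ with t | t
        · exact t.2
        · exact absurd hj t.2
      refine Set.ssubset_iff_of_subset ?_ |>.2 ⟨c j, ⟨hj, hjJ⟩, fun hx => hmem _ (Or.inl hx) ⟨j, rfl⟩⟩
      intro x hx
      have := hmem x (Or.inl hx)
      rcases hx with ⟨t | t, hxJ⟩
      · exact ⟨t.1, hxJ⟩
      · exact absurd t.1 this
    · intro x hx
      have := hmem x hx
      simp only [Set.mem_symmDiff] at hx ⊢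
      grind

theorem tsReach_of_forall_not_badCycle [Finite V] (hconn : G.Connected) (hcf : ClawFree G)
    {I J : Set V} (hI : Indep G I) (hJ : Indep G J) (hcard : I.ncard = J.ncard)
    (h : ∀ n c, IsBadCycle G I n c → ¬Set.range c ⊆ symmDiff I J) : TSReach G I J :=
  tsReach_of_forall_badCycle hconn hcf (fun _ _ _ => False) (fun _ _ _ _ _ => id)
    (fun _ _ _ _ _ => False.elim) hI hJ hcard h

theorem TSStep.ncard_eq [Finite V] {I J : Set V} (h : TSStep G I J) : I.ncard = J.ncard := by
  obtain ⟨s, u, v, -, hu, hv, rfl, rfl⟩ := h.exists_insert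
  rw [Set.ncard_insert_of_notMem hu (Set.toFinite _), Set.ncard_insert_of_notMem hv (Set.toFinite _)]

/-- After one slide, either the flip of a bad cycle is reachable, or the cycle survives with the
same vertices outside the independent set. -/
theorem IsBadCycle.tsStep [Finite V] (hconn : G.Connected) (hcf : ClawFree G) {I K : Set V} {n : ℕ}
    {c : ZMod (2 * n) → V} (h : IsBadCycle G I n c) (hIK : TSStep G I K) :
    TSReach G K (symmDiff I (Set.range c)) ∨
      ∃ c', IsBadCycle G K n c' ∧ (∀ j, ¬Even j.val → c' j = c j) ∧
        TSReach G (symmDiff K (Set.range c')) (symmDiff I (Set.range c)) := by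
  have hI := hIK.1
  have hK := hIK.2.1
  have hcardIK := hIK.ncard_eq
  obtain ⟨s, u, v, huv, hus, hvs, rfl, rfl⟩ := hIK.exists_insert
  by_cases hu : u ∈ Set.range c
  · obtain ⟨k, rfl⟩ := hu
    by_cases hadj : G.Adj v (c (k + 1)) ∧ G.Adj v (c (k - 1))
    · have hvI : v ∉ insert (c k) s := by
        rintro (e | e)
        · exact huv.ne e.symm
        · exact hvs e
      have hb := h.update hcf hK hvI hadj.1 hadj.2
      have hvc : v ∉ Set.range c := by
        rintro ⟨y, rfl⟩
        have := hb.2.1.ne (a₁ := y) (a₂ := k)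
        grind
      refine Or.inr ⟨_, hb, fun j hj => Function.update_of_ne ?_ _ _, ?_⟩
      · rintro rfl
        rw [← h.2.2.2.2] at hj
        exact hj (Set.mem_insert _ _)
      · rw [h.range_update]
        have e : symmDiff (insert v s) (insert v (Set.range c \ {c k})) =
            symmDiff (insert (c k) s) (Set.range c) := by
          have hck : c k ∈ Set.range c := ⟨k, rfl⟩
          ext x
          simp only [Set.mem_symmDiff, Set.mem_insert_iff, Set.mem_sdiff, Set.mem_singleton_iff]
          grind
        rw [e]
        exact .refl
    · left
      exact tsReach_of_forall_not_badCycle hconn hcf hK (h.indep_symmDiff hcf hI)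
        (hcardIK.symm.trans h.ncard_symmDiff.symm)
        fun m d hd => h.not_badCycle_of_slide hcf hI hus hadj hd hK
  · right
    have hvc : v ∉ Set.range c := by
      rintro ⟨j, rfl⟩
      have hj : c j ∉ insert u s := by
        rintro (e | e)
        · exact hu ⟨j, e⟩
        · exact hvs e
      refine hK _ (Set.mem_insert _ _) _ (Set.mem_insert_of_mem _ ?_) (h.2.2.1 j)
      exact ((h.mem_add_one j).2 hj).resolve_left fun e => hu ⟨_, e⟩
    have hb : IsBadCycle G (insert v s) n c := h.of_mem_iff fun j => by
      have h1 : c j ≠ u := fun e => hu ⟨j, e⟩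
      have h2 : c j ≠ v := fun e => hvc ⟨j, e⟩
      simp [h1, h2]
    refine ⟨c, hb, fun _ _ => rfl, .single ?_⟩
    have e : ∀ w, w ∉ Set.range c → w ∉ s →
        symmDiff (insert w s) (Set.range c) = insert w (symmDiff s (Set.range c)) := by
      intro w hw hws
      ext x
      simp only [Set.mem_symmDiff, Set.mem_insert_iff]
      grind
    have hflI := h.indep_symmDiff hcf hI
    have hflK := hb.indep_symmDiff hcf hK
    rw [e u hu hus] at hflI ⊢
    rw [e v hvc hvs] at hflK ⊢
    refine tsStep_insert huv.symm hflK hflI ?_ ?_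
    · rintro (t | t)
      · exact hvs t.1
      · exact hvc t.1
    · rintro (t | t)
      · exact hus t.1
      · exact hu t.1

/-- A resolvable bad cycle can be flipped. -/
theorem IsBadCycle.tsReach_symmDiff [Finite V] (hconn : G.Connected) (hcf : ClawFree G)
    {I : Set V} {n : ℕ} {c : ZMod (2 * n) → V} (h : IsBadCycle G I n c)
    (hres : Resolvable G I c) : TSReach G I (symmDiff I (Set.range c)) := by
  obtain ⟨I', hr, hac⟩ := hres
  have key : TSReach G I (symmDiff I (Set.range c)) ∨
      ∃ c', IsBadCycle G I' n c' ∧ (∀ j, ¬Even j.val → c' j = c j) ∧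
        TSReach G (symmDiff I' (Set.range c')) (symmDiff I (Set.range c)) := by
    clear hac
    induction hr with
    | refl => exact Or.inr ⟨c, h, fun _ _ => rfl, .refl⟩
    | tail hr hs ih =>
      rcases ih with ih | ⟨c', hb, hc', hr'⟩
      · exact Or.inl ih
      · rcases hb.tsStep hconn hcf hs with h1 | ⟨c'', hb', hc'', hr''⟩
        · exact Or.inl (((hr.tail hs).trans h1).trans hr')
        · exact Or.inr ⟨c'', hb', fun j hj => (hc'' j hj).trans (hc' j hj), hr''.trans hr'⟩
  rcases key with h1 | ⟨c', hb, hc', -⟩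
  · exact h1
  · refine absurd hac (hb.not_isAcyclic ?_)
    rintro _ ⟨j, rfl⟩
    by_cases hj : Even j.val
    · exact Or.inl ((hb.2.2.2.2 j).2 hj)
    · exact Or.inr ⟨j, hj, (hc' j hj).symm⟩

end TokenSliding

/-- In a connected claw-free graph, `I` and `J` are TS-reachable from each other iff
every (bad) cycle of `G[I △ J]` is resolvable with respect to `I`. -/
theorem stmt_17 {V : Type} [Fintype V] [DecidableEq V] (G : SimpleGraph V)
    (hconn : G.Connected) (hcf : ClawFree G)
    (I J : Set V) (hI : Indep G I) (hJ : Indep G J) (hcard : I.ncard = J.ncard) :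
    TSReach G I J ↔
    (∀ (n : ℕ) (c : ZMod (2*n) → V), IsBadCycle G I n c →
      Set.range c ⊆ symmDiff I J → Resolvable G I c) := by
  constructor
  · intro hr n c hb hc
    refine ⟨J, hr, ?_⟩
    have hsub : J ∪ cycB c ⊆ J := by
      rintro x (hx | ⟨j, hj, rfl⟩)
      · exact hx
      · rcases hc ⟨j, rfl⟩ with t | t
        · exact absurd ((hb.2.2.2.2 j).1 t.1) hj
        · exact t.1
    have hbot : G.induce (J ∪ cycB c) = ⊥ := by
      ext x y
      simpa using hJ _ (hsub x.2) _ (hsub y.2)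
    rw [hbot]
    exact SimpleGraph.isAcyclic_bot
  · exact tsReach_of_forall_badCycle hconn hcf (fun I _ c => Resolvable G I c)
      (fun I I' n c hr ⟨K, hK, hac⟩ => ⟨K, hr.symm.trans hK, hac⟩)
      (fun I n c _ hb hres => hb.tsReach_symmDiff hconn hcf hres) hI hJ hcard
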